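/- Let n ≥ 4 be an even integer, and let K⁺_{n/2+1,n/2−1} be the graph on n vertices obtained from the complete bipartite graph with parts of sizes n/2 + 1 and n/2 − 1 by adding exactly one edge inside the part of size n/2 + 1. Then λ(K⁺_{n/2+1,n/2−1}) > n/2, while the number of triangles in K⁺_{n/2+1,n/2−1} is exactly n/2 − 1. In particular, λ(G) > λ(T_{n,2}) = n/2 does not force a graph G on n vertices to contain at least ⌊n/2⌋ triangles. -/

import Mathlib

open Matrix

/-- The spectral radius of a finite simple graph: the largest eigenvalue of its
adjacency matrix (as a real symmetric matrix), expressed as the supremum of the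
set of eigenvalues of the associated linear endomorphism. -/
noncomputable def specRad {V : Type*} [Fintype V] (G : SimpleGraph V) : ℝ :=
  letI := Classical.decEq V
  letI := Classical.decRel G.Adj
  sSup {μ : ℝ | Module.End.HasEigenvalue (Matrix.toLin' (SimpleGraph.adjMatrix ℝ G)) μ}

/-- The number of triangles (3-cliques) of a finite simple graph. -/
noncomputable def triangleCount {V : Type*} [Fintype V] (G : SimpleGraph V) : ℕ :=
  letI := Classical.decEq V
  letI := Classical.decRel G.Adj
  (G.cliqueFinset 3).card

/-- The graph on `Fin n` obtained from the complete bipartite graph with parts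
`{0, …, a-1}` and `{a, …, n-1}` by adding the extra edge `{0, 1}` inside the
first part. -/
def KbipPlus (n a : ℕ) : SimpleGraph (Fin n) :=
  SimpleGraph.fromRel (fun u v => ((u : ℕ) < a ∧ a ≤ (v : ℕ)) ∨ ((u : ℕ) = 0 ∧ (v : ℕ) = 1))

/-- `K⁺_{⌈n/2⌉,⌊n/2⌋}`: the complete bipartite graph with parts of sizes `⌈n/2⌉`
and `⌊n/2⌋` together with one extra edge inside the part of size `⌈n/2⌉`
(added between vertices `0` and `1`). -/
def Kplus (n : ℕ) : SimpleGraph (Fin n) := KbipPlus n ((n + 1) / 2)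

/-- `K^{+|}`: the graph on `Fin n` obtained from the complete bipartite graph with
parts `{0, …, a-1}` and `{a, …, n-1}` by adding the edge `e₁ = {0, 1}` inside the
first part and deleting the cross edge `e₂ = {0, a}`, which shares the endpoint `0`
with `e₁`. -/
def KbipPlusMinus (n a : ℕ) : SimpleGraph (Fin n) :=
  SimpleGraph.fromRel (fun u v =>
    (((u : ℕ) < a ∧ a ≤ (v : ℕ)) ∧ ¬((u : ℕ) = 0 ∧ (v : ℕ) = a)) ∨
      ((u : ℕ) = 0 ∧ (v : ℕ) = 1))

theorem kbipPlus_adj {n a : ℕ} (u v : Fin n) :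
    (KbipPlus n a).Adj u v ↔ u ≠ v ∧
      ((((u : ℕ) < a ∧ a ≤ (v : ℕ)) ∨ ((u : ℕ) = 0 ∧ (v : ℕ) = 1)) ∨
        (((v : ℕ) < a ∧ a ≤ (u : ℕ)) ∨ ((v : ℕ) = 0 ∧ (u : ℕ) = 1))) :=
  SimpleGraph.fromRel_adj _ u v

theorem sum_fin_two_add_add (b c : ℕ) (F : ℕ → ℝ) :
    ∑ i : Fin (2 + b + c), F i =
      F 0 + F 1 + ∑ i ∈ Finset.range b, F (2 + i) + ∑ i ∈ Finset.range c, F (2 + b + i) := by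
  rw [← Finset.sum_range, Finset.sum_range_add, Finset.sum_range_add, Finset.sum_range_succ,
    Finset.sum_range_one]

theorem le_specRad_of_mulVec_eq {V : Type*} [Fintype V] (G : SimpleGraph V) [DecidableRel G.Adj]
    {μ : ℝ} {f : V → ℝ} (hf : f ≠ 0) (h : G.adjMatrix ℝ *ᵥ f = μ • f) : μ ≤ specRad G := by
  classical
  unfold specRad
  apply le_csSup
  · exact (Module.End.finite_hasEigenvalue _).bddAbove
  · refine Module.End.hasEigenvalue_of_hasEigenvector (x := f) ⟨?_, hf⟩
    rw [Module.End.mem_eigenspace_iff, Matrix.toLin'_apply, ← h]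
    congr!

/-- The cubic is the characteristic polynomial of the quotient of `KbipPlus (2 + b + b) (2 + b)`
by the equitable partition into the ends of the extra edge, the rest of their part, and the
other part. -/
theorem exists_root_quotient_cubic {b : ℝ} (hb : 0 < b) :
    ∃ l : ℝ, b + 1 < l ∧ l ^ 2 * (l - 1) = 2 * b * l + b ^ 2 * (l - 1) := by
  have hc : ContinuousOn (fun l : ℝ => l ^ 2 * (l - 1) - (2 * b * l + b ^ 2 * (l - 1)))
      (Set.Icc (b + 1) (b + 2)) := by fun_prop
  obtain ⟨l, hl, h⟩ := intermediate_value_Ioo (by linarith) hc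
    (show (0 : ℝ) ∈ Set.Ioo _ _ by constructor <;> nlinarith [sq_nonneg b])
  exact ⟨l, hl.1, by linarith [show _ = (0 : ℝ) from h]⟩

theorem lt_specRad_kbipPlus (b : ℕ) (hb : 1 ≤ b) :
    (b : ℝ) + 1 < specRad (KbipPlus (2 + b + b) (2 + b)) := by
  classical
  have hb' : (0 : ℝ) < b := by exact_mod_cast hb
  obtain ⟨l, hl, h⟩ := exists_root_quotient_cubic hb'
  refine hl.trans_le ?_
  let g : ℕ → ℝ := fun i => if i < 2 then l * b else if i < 2 + b then (l - 1) * b else l * (l - 1)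
  refine le_specRad_of_mulVec_eq _ (f := fun v => g v) ?_ ?_
  · intro h0
    have h1 := congrFun h0 ⟨0, by omega⟩
    simp only [g, Pi.zero_apply, Nat.ofNat_pos, if_true] at h1
    have : 0 < l * b := by apply mul_pos <;> linarith
    linarith
  · ext u
    obtain ⟨u, hu⟩ := u
    let F : ℕ → ℝ := fun j =>
      if u ≠ j ∧ (((u < 2 + b ∧ 2 + b ≤ j) ∨ (u = 0 ∧ j = 1)) ∨
        ((j < 2 + b ∧ 2 + b ≤ u) ∨ (j = 0 ∧ u = 1))) then g j else 0
    have row : ∀ v : Fin (2 + b + b),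
        (KbipPlus (2 + b + b) (2 + b)).adjMatrix ℝ ⟨u, hu⟩ v * g v = F v := by
      intro v
      simp only [F, SimpleGraph.adjMatrix_apply, kbipPlus_adj, ne_eq, Fin.ext_iff, ite_mul,
        one_mul, zero_mul]
    have zero : F 0 = if u = 1 ∨ 2 + b ≤ u then l * b else 0 := by
      grind
    have one : F 1 = if u = 0 ∨ 2 + b ≤ u then l * b else 0 := by
      grind
    have mid : ∀ i ∈ Finset.range b, F (2 + i) = if 2 + b ≤ u then (l - 1) * b else 0 := by
      intro i hi
      have := Finset.mem_range.1 hi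
      simp only [F, g]
      split_ifs <;> first | rfl | omega
    have last : ∀ i ∈ Finset.range b, F (2 + b + i) = if u < 2 + b then l * (l - 1) else 0 := by
      intro i hi
      simp only [F, g]
      split_ifs <;> first | rfl | omega
    simp only [Matrix.mulVec, dotProduct, row, Pi.smul_apply, smul_eq_mul]
    rw [sum_fin_two_add_add b b F, zero, one, Finset.sum_congr rfl mid, Finset.sum_congr rfl last]
    simp only [Finset.sum_const, Finset.card_range, nsmul_eq_mul, g]
    split_ifs <;> first | omega | linarith

theorem triangleCount_kbipPlus (b : ℕ) :
    triangleCount (KbipPlus (2 + b + b) (2 + b)) = b := by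
  classical
  let T : Fin b → Finset (Fin (2 + b + b)) := fun i =>
    {⟨0, by omega⟩, ⟨1, by omega⟩, ⟨2 + b + i, by omega⟩}
  have hT : Function.Injective T := by
    intro i j hij
    have h : (⟨2 + b + i, by omega⟩ : Fin (2 + b + b)) ∈ T j := by
      rw [← hij]
      simp [T]
    simp only [T, Finset.mem_insert, Finset.mem_singleton, Fin.mk.injEq] at h
    omega
  have himage : (KbipPlus (2 + b + b) (2 + b)).cliqueFinset 3 = Finset.univ.image T := by
    ext s
    simp only [SimpleGraph.mem_cliqueFinset_iff, SimpleGraph.is3Clique_iff, Finset.mem_image,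
      Finset.mem_univ, true_and, kbipPlus_adj, ne_eq, Fin.ext_iff]
    constructor
    · rintro ⟨x, y, z, hxy, hxz, hyz, rfl⟩
      have hmax : ∃ i : Fin b, (x : ℕ) = 2 + b + i ∨ (y : ℕ) = 2 + b + i ∨ (z : ℕ) = 2 + b + i := by
        by_cases hx : 2 + b ≤ (x : ℕ)
        · exact ⟨⟨x - (2 + b), by omega⟩, by simp only; omega⟩
        by_cases hy : 2 + b ≤ (y : ℕ)
        · exact ⟨⟨y - (2 + b), by omega⟩, by simp only; omega⟩
        · exact ⟨⟨z - (2 + b), by omega⟩, by simp only; omega⟩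
      obtain ⟨i, hi⟩ := hmax
      refine ⟨i, ?_⟩
      ext w
      simp only [T, Finset.mem_insert, Finset.mem_singleton, Fin.ext_iff]
      omega
    · rintro ⟨i, rfl⟩
      refine ⟨⟨0, by omega⟩, ⟨1, by omega⟩, ⟨2 + b + i, by omega⟩, ?_, ?_, ?_, rfl⟩ <;>
        grind
  have hcard : triangleCount (KbipPlus (2 + b + b) (2 + b)) = (Finset.univ.image T).card := by
    rw [← himage]
    unfold triangleCount
    congr!
  rw [hcard, Finset.card_image_of_injective _ hT, Finset.card_univ, Fintype.card_fin]

/-- For even `n ≥ 4`, the graph `K⁺_{n/2+1,n/2−1}` satisfies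
`λ(K⁺_{n/2+1,n/2−1}) > n/2` while it has exactly `n/2 − 1` triangles. In particular,
`λ(G) > λ(T_{n,2}) = n/2` does not force an `n`-vertex graph `G` to have at least
`⌊n/2⌋` triangles. -/
theorem specRad_gt_half_not_enough (n : ℕ) (hn : 4 ≤ n) (he : Even n) :
    (n : ℝ) / 2 < specRad (KbipPlus n (n / 2 + 1)) ∧
      triangleCount (KbipPlus n (n / 2 + 1)) = n / 2 - 1 ∧
      ¬ (∀ G : SimpleGraph (Fin n), (n : ℝ) / 2 < specRad G → n / 2 ≤ triangleCount G) := by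
  obtain ⟨b, hb, rfl⟩ : ∃ b, 1 ≤ b ∧ n = 2 + b + b := by
    obtain ⟨m, rfl⟩ := he
    exact ⟨m - 1, by omega, by omega⟩
  have ha : (2 + b + b) / 2 + 1 = 2 + b := by omega
  have hspec : ((2 + b + b : ℕ) : ℝ) / 2 < specRad (KbipPlus (2 + b + b) (2 + b)) := by
    have := lt_specRad_kbipPlus b hb
    push_cast
    linarith
  have ht := triangleCount_kbipPlus b
  rw [ha]
  refine ⟨hspec, ht.trans (by omega), fun h => ?_⟩
  have := ht ▸ h _ hspec
  omega
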